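/- Let k be a field and S = k[x_1,...,x_n]. Let f be a homogeneous cubic contained in the ideal I = (P_1) ∩ ... ∩ (P_s), where P_1,...,P_s are subspaces of linear forms with P_1 ∩ ... ∩ P_s = 0, and set W = P_1 + ... + P_s. Suppose P is a subspace of linear forms with dim P = rk(f) and f ∈ (P), and suppose the degree-2 component satisfies I_2 ⊆ (P). Then P ⊆ W. -/

import Mathlib

open MvPolynomial

/-- The slice rank of a polynomial: minimal `r` such that `f` lies in an ideal
generated by `r` linear forms. -/
noncomputable def sliceRank {k : Type*} [Field k] {σ : Type*} (f : MvPolynomial σ k) : ℕ :=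
  sInf {r : ℕ | ∃ ℓ : Fin r → MvPolynomial σ k,
    (∀ i, (ℓ i).IsHomogeneous 1) ∧ f ∈ Ideal.span (Set.range ℓ)}

namespace MvPolynomial

variable {k σ : Type*} [Field k]

/-- An algebra homomorphism agreeing with a linear map on the variables agrees with it on all
linear forms. -/
theorem IsHomogeneous.algHom_apply_eq {A : Type*} [CommRing A] [Algebra k A]
    {p : MvPolynomial σ k} (hp : p.IsHomogeneous 1) (φ : MvPolynomial σ k →ₐ[k] A)
    (L : MvPolynomial σ k →ₗ[k] A) (h : ∀ i, φ (X i) = L (X i)) : φ p = L p := by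
  have hp' : p ∈ Submodule.span k (Set.range (X : σ → MvPolynomial σ k)) := by
    rw [← homogeneousSubmodule_one_eq_span_X]
    exact hp
  refine LinearMap.eqOn_span (f := φ.toLinearMap) (g := L) ?_ hp'
  rintro _ ⟨i, rfl⟩
  exact h i

/-- The substitution of linear forms given by a linear map. -/
noncomputable def linearSubst {A : Type*} [CommRing A] [Algebra k A]
    (L : MvPolynomial σ k →ₗ[k] A) : MvPolynomial σ k →ₐ[k] A :=
  aeval fun i => L (X i)

@[simp]
theorem linearSubst_X {A : Type*} [CommRing A] [Algebra k A]
    (L : MvPolynomial σ k →ₗ[k] A) (i : σ) : linearSubst L (X i) = L (X i) :=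
  aeval_X _ i

theorem IsHomogeneous.linearSubst_apply {A : Type*} [CommRing A] [Algebra k A]
    {p : MvPolynomial σ k} (hp : p.IsHomogeneous 1) (L : MvPolynomial σ k →ₗ[k] A) :
    linearSubst L p = L p :=
  hp.algHom_apply_eq _ L (linearSubst_X L)

/-- A linear form in the ideal generated by a space `P` of linear forms lies in `P`. -/
theorem IsHomogeneous.mem_of_mem_span {P : Submodule k (MvPolynomial σ k)}
    (hP : P ≤ homogeneousSubmodule σ k 1) {p : MvPolynomial σ k} (hp : p.IsHomogeneous 1)
    (h : p ∈ Ideal.span (P : Set (MvPolynomial σ k))) : p ∈ P := by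
  obtain ⟨C, hC⟩ := exists_isCompl P
  let ρ := C.projection P hC.symm
  have hker : Ideal.span (P : Set (MvPolynomial σ k)) ≤ RingHom.ker (linearSubst ρ) := by
    refine Ideal.span_le.mpr fun q hq => ?_
    rw [SetLike.mem_coe, RingHom.mem_ker, (show q.IsHomogeneous 1 from hP hq).linearSubst_apply]
    exact (Submodule.projection_apply_eq_zero_iff hC.symm).mpr hq
  have := hker h
  rw [RingHom.mem_ker, hp.linearSubst_apply] at this
  exact (Submodule.projection_apply_eq_zero_iff hC.symm).mp this

theorem eq_zero_of_isHomogeneous_zero_of_mem_span {P : Submodule k (MvPolynomial σ k)}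
    (hP : P ≤ homogeneousSubmodule σ k 1) {p : MvPolynomial σ k} (hp : p.IsHomogeneous 0)
    (h : p ∈ Ideal.span (P : Set (MvPolynomial σ k))) : p = 0 := by
  have hker : Ideal.span (P : Set (MvPolynomial σ k)) ≤ RingHom.ker constantCoeff := by
    refine Ideal.span_le.mpr fun q hq => ?_
    rw [SetLike.mem_coe, RingHom.mem_ker, constantCoeff_eq]
    exact (show q.IsHomogeneous 1 from hP hq).coeff_eq_zero (by simp)
  have h0 := hker h
  rw [RingHom.mem_ker, constantCoeff_eq] at h0
  ext d
  by_cases hd : d = 0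
  · simpa [hd] using h0
  · exact hp.coeff_eq_zero fun h => hd ((Finsupp.degree_eq_zero_iff d).mp h)

variable (σ k) in
/-- Polynomials with polynomial coefficients which are homogeneous of total degree `d`
in both sets of variables together. -/
def jointlyHomogeneous (d : ℕ) : Submodule k (MvPolynomial σ (MvPolynomial σ k)) where
  carrier := {F | ∀ m u, coeff u (coeff m F) ≠ 0 → m.degree + u.degree = d}
  add_mem' {F G} hF hG m u h := by
    rw [coeff_add, coeff_add] at h
    by_cases hFu : coeff u (coeff m F) = 0
    · exact hG m u fun hGu => h (by rw [hFu, hGu, add_zero])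
    · exact hF m u hFu
  zero_mem' m u h := by simp at h
  smul_mem' c F hF m u h := by
    refine hF m u fun h0 => h ?_
    rw [coeff_smul, coeff_smul, h0, smul_zero]

theorem mem_jointlyHomogeneous {d : ℕ} {F : MvPolynomial σ (MvPolynomial σ k)} :
    F ∈ jointlyHomogeneous k σ d ↔
      ∀ m u, coeff u (coeff m F) ≠ 0 → m.degree + u.degree = d :=
  Iff.rfl

instance jointlyHomogeneous.gradedMonoid :
    SetLike.GradedMonoid (jointlyHomogeneous k σ) where
  one_mem m u h := by
    classical
    rw [coeff_one] at h
    split_ifs at h with hm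
    · rw [coeff_one] at h
      split_ifs at h with hu
      · simp [← hm, ← hu]
      · exact absurd rfl h
    · simp at h
  mul_mem i j F G hF hG m u h := by
    classical
    rw [coeff_mul, coeff_sum] at h
    obtain ⟨a, ha, h⟩ := Finset.exists_ne_zero_of_sum_ne_zero h
    rw [coeff_mul] at h
    obtain ⟨b, hb, h⟩ := Finset.exists_ne_zero_of_sum_ne_zero h
    rw [Finset.HasAntidiagonal.mem_antidiagonal] at ha hb
    have h₁ := hF _ _ (left_ne_zero_of_mul h)
    have h₂ := hG _ _ (right_ne_zero_of_mul h)
    rw [← ha, ← hb, map_add, map_add]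
    omega

theorem C_mem_jointlyHomogeneous {d : ℕ} {p : MvPolynomial σ k} (hp : p.IsHomogeneous d) :
    C p ∈ jointlyHomogeneous k σ d := fun m u h => by
  classical
  rw [coeff_C] at h
  split_ifs at h with hm
  · rw [← hm, map_zero, zero_add]
    by_contra hu
    exact h (hp.coeff_eq_zero hu)
  · simp at h

theorem map_C_mem_jointlyHomogeneous {d : ℕ} {p : MvPolynomial σ k} (hp : p.IsHomogeneous d) :
    map C p ∈ jointlyHomogeneous k σ d := fun m u h => by
  classical
  rw [coeff_map, coeff_C] at h
  split_ifs at h with hu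
  · rw [← hu, map_zero, add_zero]
    by_contra hm
    exact h (hp.coeff_eq_zero hm)
  · simp at h

theorem IsHomogeneous.algHom_mem_jointlyHomogeneous {d : ℕ} {p : MvPolynomial σ k}
    (hp : p.IsHomogeneous d) (φ : MvPolynomial σ k →ₐ[k] MvPolynomial σ (MvPolynomial σ k))
    (h : ∀ i, φ (X i) ∈ jointlyHomogeneous k σ 1) : φ p ∈ jointlyHomogeneous k σ d := by
  rw [p.as_sum, map_sum]
  refine Submodule.sum_mem _ fun m hm => ?_
  have hdeg : m.degree = d := by
    by_contra hne
    exact mem_support_iff.mp hm (hp.coeff_eq_zero hne)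
  rw [monomial_eq, ← smul_eq_C_mul, map_smul, Finsupp.prod, map_prod]
  refine Submodule.smul_mem _ _ ?_
  have := SetLike.prod_pow_mem_graded (jointlyHomogeneous k σ) (fun _ => 1)
    (fun i => φ (X i)) (F := m.support) m fun i _ => h i
  simpa [← hdeg, Finsupp.degree_apply] using this

/-- The substitution `x ↦ π x + (x - π x)`, where the second summand is written in a new set
of variables. -/
noncomputable def splitHom (π : MvPolynomial σ k →ₗ[k] MvPolynomial σ k) :
    MvPolynomial σ k →ₐ[k] MvPolynomial σ (MvPolynomial σ k) :=
  linearSubst ((IsScalarTower.toAlgHom k (MvPolynomial σ k)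
      (MvPolynomial σ (MvPolynomial σ k))).toLinearMap ∘ₗ π +
    (mapAlgHom (Algebra.ofId k (MvPolynomial σ k))).toLinearMap ∘ₗ (LinearMap.id - π))

theorem splitHom_X (π : MvPolynomial σ k →ₗ[k] MvPolynomial σ k) (i : σ) :
    splitHom π (X i) = C (π (X i)) + map C (X i - π (X i)) := by
  rw [splitHom, linearSubst_X]
  rfl

theorem splitHom_apply_of_fixed {π : MvPolynomial σ k →ₗ[k] MvPolynomial σ k}
    {p : MvPolynomial σ k} (hp : p.IsHomogeneous 1) (hπ : π p = p) : splitHom π p = C p := by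
  rw [splitHom, hp.linearSubst_apply]
  simp [hπ, algebraMap_eq]

theorem eval_X_splitHom (π : MvPolynomial σ k →ₗ[k] MvPolynomial σ k) (p : MvPolynomial σ k) :
    eval X (splitHom π p) = p := by
  have hmap : ∀ q : MvPolynomial σ k, eval X (map C q) = q := fun q => by
    rw [eval_map, eval₂_eta]
  induction p using MvPolynomial.induction_on with
  | C a =>
    rw [← algebraMap_eq, AlgHom.commutes, IsScalarTower.algebraMap_apply k (MvPolynomial σ k)]
    exact eval_C _
  | add p q hp hq => rw [map_add, map_add, hp, hq]
  | mul_X p i hp =>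
    rw [map_mul, map_mul, hp, splitHom_X, map_add, eval_C, hmap, add_sub_cancel]

theorem constantCoeff_splitHom {π : MvPolynomial σ k →ₗ[k] MvPolynomial σ k}
    (hπ : ∀ i, (π (X i)).IsHomogeneous 1) (p : MvPolynomial σ k) :
    constantCoeff (splitHom π p) = linearSubst π p := by
  induction p using MvPolynomial.induction_on with
  | C a =>
    rw [← algebraMap_eq, AlgHom.commutes, AlgHom.commutes,
      IsScalarTower.algebraMap_apply k (MvPolynomial σ k)]
    exact constantCoeff_C _ _
  | add p q hp hq => rw [map_add, map_add, hp, hq, map_add]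
  | mul_X p i hp =>
    rw [map_mul, map_mul, hp, map_mul, splitHom_X, linearSubst_X, map_add, constantCoeff_C,
      constantCoeff_map, constantCoeff_eq,
      ((isHomogeneous_X k i).sub (hπ i)).coeff_eq_zero (by simp), map_zero, add_zero]

theorem map_linearSubst_splitHom {π : MvPolynomial σ k →ₗ[k] MvPolynomial σ k}
    (hπ : ∀ i, (π (X i)).IsHomogeneous 1) (hπ' : ∀ p, π (π p) = π p) (p : MvPolynomial σ k) :
    map (linearSubst π : MvPolynomial σ k →+* MvPolynomial σ k) (splitHom π p) =
      splitHom π p := by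
  induction p using MvPolynomial.induction_on with
  | C a =>
    rw [← algebraMap_eq, AlgHom.commutes, IsScalarTower.algebraMap_apply k (MvPolynomial σ k),
      algebraMap_eq, map_C, RingHom.coe_coe, AlgHom.commutes]
  | add p q hp hq => rw [map_add, map_add, hp, hq]
  | mul_X p i hp =>
    have hC : ((linearSubst π : MvPolynomial σ k →ₐ[k] MvPolynomial σ k) :
        MvPolynomial σ k →+* MvPolynomial σ k).comp C = C :=
      (linearSubst π).comp_algebraMap
    rw [map_mul, map_mul, hp, splitHom_X, map_add, map_C, RingHom.coe_coe,
      (hπ i).linearSubst_apply, hπ', map_map, hC]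

theorem splitHom_mem_map_C {π : MvPolynomial σ k →ₗ[k] MvPolynomial σ k}
    {P : Submodule k (MvPolynomial σ k)} (hP : P ≤ homogeneousSubmodule σ k 1)
    (hπ : ∀ p ∈ P, π p = p) {f : MvPolynomial σ k}
    (hf : f ∈ Ideal.span (P : Set (MvPolynomial σ k))) :
    splitHom π f ∈ (Ideal.span (P : Set (MvPolynomial σ k))).map (C (σ := σ)) := by
  refine Ideal.mem_comap.mp (Ideal.span_le.mpr (fun p hp => ?_) hf)
  rw [SetLike.mem_coe, Ideal.mem_comap, splitHom_apply_of_fixed (hP hp) (hπ p hp)]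
  exact Ideal.mem_map_of_mem _ (Ideal.subset_span hp)

theorem linearSubst_mem_span {π : MvPolynomial σ k →ₗ[k] MvPolynomial σ k}
    {Q R : Submodule k (MvPolynomial σ k)} (hQ : Q ≤ homogeneousSubmodule σ k 1)
    (hπ : ∀ q ∈ Q, π q ∈ R) {f : MvPolynomial σ k}
    (hf : f ∈ Ideal.span (Q : Set (MvPolynomial σ k))) :
    linearSubst π f ∈ Ideal.span (R : Set (MvPolynomial σ k)) := by
  refine Ideal.mem_comap.mp (Ideal.span_le.mpr (fun q hq => ?_) hf)
  rw [SetLike.mem_coe, Ideal.mem_comap, (show q.IsHomogeneous 1 from hQ hq).linearSubst_apply]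
  exact Ideal.subset_span (hπ q hq)

end MvPolynomial

/-- There is a projection onto `W` mapping `Q` into `Q ⊓ W`. -/
theorem Submodule.exists_projection_map_le_inf {k V : Type*} [Field k] [AddCommGroup V]
    [Module k V] (W Q : Submodule k V) :
    ∃ π : V →ₗ[k] V, (∀ v, π v ∈ W) ∧ (∀ w ∈ W, π w = w) ∧ ∀ q ∈ Q, π q ∈ Q ⊓ W := by
  obtain ⟨Q', hdisj, hsup⟩ :=
    IsModularLattice.exists_disjoint_and_sup_eq (inf_le_left : Q ⊓ W ≤ Q)
  have hQ' : Q' ≤ Q := hsup ▸ le_sup_right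
  have hdisj' : Disjoint Q' W := by
    rw [Submodule.disjoint_def] at hdisj ⊢
    exact fun x hx hW => hdisj x ⟨hQ' hx, hW⟩ hx
  obtain ⟨C, hC, hcompl⟩ := hdisj'.exists_isCompl
  refine ⟨W.projection C hcompl.symm, Submodule.projection_apply_mem _,
    fun w => Submodule.projection_apply_of_mem_left _, fun q hq => ?_⟩
  rw [← hsup] at hq
  obtain ⟨a, ha, b, hb, rfl⟩ := Submodule.mem_sup.mp hq
  rw [map_add, Submodule.projection_apply_of_mem_left _ ha.2,
    (Submodule.projection_apply_eq_zero_iff hcompl.symm).mpr (hC hb), add_zero]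
  exact ha

theorem sliceRank_le_finrank {k σ : Type*} [Field k] {f : MvPolynomial σ k}
    (R : Submodule k (MvPolynomial σ k)) [Module.Finite k R]
    (hR : R ≤ homogeneousSubmodule σ k 1)
    (hf : f ∈ Ideal.span (R : Set (MvPolynomial σ k))) : sliceRank f ≤ Module.finrank k R := by
  let b := Module.finBasis k R
  refine Nat.sInf_le ⟨fun i => (b i : MvPolynomial σ k), fun i => hR (b i).2, ?_⟩
  refine Ideal.span_le.mpr (fun x hx => ?_) hf
  have hx' : ((∑ i, b.repr ⟨x, hx⟩ i • b i : R) : MvPolynomial σ k) = x :=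
    congrArg Subtype.val (b.sum_repr ⟨x, hx⟩)
  rw [← hx', Submodule.coe_sum]
  refine Ideal.sum_mem _ fun i _ => ?_
  rw [Submodule.coe_smul]
  exact Submodule.smul_of_tower_mem _ _ (Ideal.subset_span ⟨i, rfl⟩)

/-- Let `f` be a homogeneous cubic lying in `I = (P_1) ∩ ⋯ ∩ (P_s)`, where
the `P_i` are subspaces of linear forms with trivial common intersection, and set
`W = P_1 + ⋯ + P_s`. If `P` is a subspace of linear forms with `dim P = rk f`, `f ∈ (P)`
and `I_2 ⊆ (P)`, then `P ⊆ W`. -/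
theorem plane_le_sum_of_quadratics_in_ideal
    {k : Type*} [Field k] {n : ℕ} (s : ℕ)
    (P : Fin s → Submodule k (MvPolynomial (Fin n) k))
    (hlin : ∀ i, P i ≤ homogeneousSubmodule (Fin n) k 1)
    (hint : (⨅ i, P i) = ⊥)
    (f : MvPolynomial (Fin n) k) (hf : f.IsHomogeneous 3)
    (hfI : f ∈ ⨅ i, Ideal.span ((P i : Set (MvPolynomial (Fin n) k))))
    (Q : Submodule k (MvPolynomial (Fin n) k))
    (hQlin : Q ≤ homogeneousSubmodule (Fin n) k 1)
    (hQdim : Module.finrank k Q = sliceRank f)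
    (hfQ : f ∈ Ideal.span (Q : Set (MvPolynomial (Fin n) k)))
    (hI₂ : Submodule.restrictScalars k
        (⨅ i, Ideal.span ((P i : Set (MvPolynomial (Fin n) k)))) ⊓
        homogeneousSubmodule (Fin n) k 2 ≤
      Submodule.restrictScalars k (Ideal.span (Q : Set (MvPolynomial (Fin n) k)))) :
    Q ≤ ⨆ i, P i := by
  have hs : Nonempty (Fin s) := by
    by_contra hs
    rw [not_nonempty_iff] at hs
    rw [iInf_of_empty] at hint
    exact top_ne_bot hint
  obtain ⟨i₀⟩ := hs
  have hW : (⨆ i, P i) ≤ homogeneousSubmodule (Fin n) k 1 := iSup_le hlin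
  have hQWlin : Q ⊓ ⨆ i, P i ≤ homogeneousSubmodule (Fin n) k 1 := inf_le_left.trans hQlin
  obtain ⟨π, hπW, hπfix, hπQ⟩ := Submodule.exists_projection_map_le_inf (⨆ i, P i) Q
  have hπX : ∀ i, (π (X i)).IsHomogeneous 1 := fun i => hW (hπW _)
  have hhom : splitHom π f ∈ jointlyHomogeneous k (Fin n) 3 := by
    refine hf.algHom_mem_jointlyHomogeneous _ fun i => ?_
    rw [splitHom_X]
    exact Submodule.add_mem _ (C_mem_jointlyHomogeneous (hπX i))
      (map_C_mem_jointlyHomogeneous ((isHomogeneous_X k i).sub (hπX i)))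
  have hcoeffI : ∀ m i, coeff m (splitHom π f) ∈
      Ideal.span (P i : Set (MvPolynomial (Fin n) k)) := fun m i =>
    mem_map_C_iff.mp (splitHom_mem_map_C (hlin i)
      (fun p hp => hπfix p (le_iSup P i hp)) (Ideal.mem_iInf.mp hfI i)) m
  have hcoeff : ∀ m, coeff m (splitHom π f) ∈
      Ideal.span ((Q ⊓ ⨆ i, P i : Submodule k _) : Set (MvPolynomial (Fin n) k)) := by
    intro m
    have hdeg : ∀ e, m.degree + e = 3 → (coeff m (splitHom π f)).IsHomogeneous e := by
      intro e he
      rw [← mem_homogeneousSubmodule, homogeneousSubmodule_eq_finsupp_supported]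
      intro u hu
      have := hhom m u (Finsupp.mem_support_iff.mp hu)
      change u.degree = e
      omega
    have hfix : linearSubst π (coeff m (splitHom π f)) = coeff m (splitHom π f) := by
      conv_rhs => rw [← map_linearSubst_splitHom hπX (fun p => hπfix _ (hπW p)) f]
      rw [coeff_map, RingHom.coe_coe]
    obtain h | h | h | h | h : m.degree = 0 ∨ m.degree = 1 ∨ m.degree = 2 ∨ m.degree = 3 ∨
        3 < m.degree := by omega
    · rw [(Finsupp.degree_eq_zero_iff m).mp h, ← constantCoeff_eq, constantCoeff_splitHom hπX]
      exact linearSubst_mem_span hQlin hπQ hfQ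
    · rw [← hfix]
      exact linearSubst_mem_span hQlin hπQ
        (hI₂ ⟨Ideal.mem_iInf.mpr (hcoeffI m), hdeg 2 (by omega)⟩)
    · have hmem : coeff m (splitHom π f) ∈ ⨅ i, P i := (Submodule.mem_iInf _).mpr fun i =>
        (hdeg 1 (by omega)).mem_of_mem_span (hlin i) (hcoeffI m i)
      rw [hint, Submodule.mem_bot] at hmem
      rw [hmem]
      exact zero_mem _
    · rw [eq_zero_of_isHomogeneous_zero_of_mem_span (hlin i₀) (hdeg 0 (by omega)) (hcoeffI m i₀)]
      exact zero_mem _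
    · have hzero : coeff m (splitHom π f) = 0 := by
        ext u
        by_contra hu
        have := hhom m u hu
        omega
      rw [hzero]
      exact zero_mem _
  have hfR : f ∈ Ideal.span ((Q ⊓ ⨆ i, P i : Submodule k _) : Set (MvPolynomial (Fin n) k)) := by
    rw [← eval_X_splitHom π f, eval_eq]
    exact Ideal.sum_mem _ fun m _ => Ideal.mul_mem_right _ _ (hcoeff m)
  have : Module.Finite k (homogeneousSubmodule (Fin n) k 1) :=
    Module.Finite.iff_fg.mpr (homogeneousSubmodule_fg _ _ 1)
  have : Module.Finite k Q := Submodule.finiteDimensional_of_le hQlin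
  have : Module.Finite k (Q ⊓ ⨆ i, P i : Submodule k _) :=
    Submodule.finiteDimensional_of_le hQWlin
  have hle := sliceRank_le_finrank _ hQWlin hfR
  rw [← hQdim] at hle
  exact inf_eq_left.mp (Submodule.eq_of_le_of_finrank_le inf_le_left hle)
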